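/- arXiv:1912.02618 — 2 statements merged into one kernel-verified Lean document; each statement's English description precedes it below -/
import Mathlib

section
/- Let M ⊂ ℂⁿ be a subset containing a point p, and let k be a positive integer. If Δ(M_k, p) < k, then Δ(M, p) = Δ(M_k, p). -/
open scoped ENNReal Topology

/-- Order of vanishing at `0` of a function `f` between real normed spaces:
the least `m` such that the `m`-th iterated (real) Fréchet derivative of `f` at `0`
is nonzero, and `∞` if all iterated derivatives vanish. -/
noncomputable def vOrder {E F : Type*} [NormedAddCommGroup E] [NormedSpace ℝ E]
    [NormedAddCommGroup F] [NormedSpace ℝ F] (f : E → F) : ℝ≥0∞ :=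
  ⨅ m ∈ {m : ℕ | iteratedFDeriv ℝ m f 0 ≠ 0}, (m : ℝ≥0∞)

/-- `ν(γ)` for a curve `γ : ℂ → ℂⁿ` through `p`: the minimum over the components of
the order of vanishing of `γ i - p i` at `0`. -/
noncomputable def nuCurve {n : ℕ} (γ : ℂ → Fin n → ℂ) (p : Fin n → ℂ) : ℝ≥0∞ :=
  ⨅ i : Fin n, vOrder (fun t => γ t i - p i)

/-- The set `𝒞` of (representatives of) nonconstant germs at `0 ∈ ℂ` of holomorphic
curves `γ` with `γ 0 = p`. -/
def Curves (n : ℕ) (p : Fin n → ℂ) : Set (ℂ → Fin n → ℂ) :=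
  {γ | AnalyticAt ℂ γ 0 ∧ γ 0 = p ∧ ¬ (∀ᶠ t in 𝓝 (0 : ℂ), γ t = p)}

/-- The set `I_M(p)` of (representatives of) germs at `p` of real-valued `C^∞` functions
defined in a neighborhood of `p` and vanishing on `M` near `p`. -/
def IMp (n : ℕ) (M : Set (Fin n → ℂ)) (p : Fin n → ℂ) : Set ((Fin n → ℂ) → ℝ) :=
  {r | ∃ U : Set (Fin n → ℂ), IsOpen U ∧ p ∈ U ∧ ContDiffOn ℝ (⊤ : ℕ∞) r U ∧
    ∀ z ∈ M ∩ U, r z = 0}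

/-- The D'Angelo type `Δ(M,p)` of an arbitrary set `M ⊆ ℂⁿ` at `p`:
`Δ(M,p) = sup_{γ ∈ 𝒞} inf_{r ∈ I_M(p)} ν(r∘γ)/ν(γ)`. -/
noncomputable def Delta (n : ℕ) (M : Set (Fin n → ℂ)) (p : Fin n → ℂ) : ℝ≥0∞ :=
  ⨆ γ ∈ Curves n p, ⨅ r ∈ IMp n M p,
    vOrder (fun t => r (γ t) - r p) / nuCurve γ p

/-- The Taylor polynomial `r_k` of order `k` of `r` at `p`. -/
noncomputable def taylorPoly (n k : ℕ) (r : (Fin n → ℂ) → ℝ) (p : Fin n → ℂ) :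
    (Fin n → ℂ) → ℝ :=
  fun z => ∑ j ∈ Finset.range (k + 1),
    ((j.factorial : ℝ))⁻¹ • iteratedFDeriv ℝ j r p (fun _ => z - p)

/-- `Δ(M_k,p) = sup_{γ ∈ 𝒞} inf_{r ∈ I_M(p)} ν(r_k∘γ)/ν(γ)`. -/
noncomputable def DeltaK (n : ℕ) (M : Set (Fin n → ℂ)) (p : Fin n → ℂ) (k : ℕ) : ℝ≥0∞ :=
  ⨆ γ ∈ Curves n p, ⨅ r ∈ IMp n M p,
    vOrder (fun t => taylorPoly n k r p (γ t) - taylorPoly n k r p p) / nuCurve γ p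

section SymmetryOfDerivatives

variable {E F : Type*} [NormedAddCommGroup E] [NormedSpace ℝ E]
  [NormedAddCommGroup F] [NormedSpace ℝ F]

/-- The second derivative in the two outermost arguments is symmetric. -/
theorem ContDiffAt.iteratedFDeriv_comp_swap_zero_one {f : E → F} {x : E} {n : ℕ}
    (hf : ContDiffAt ℝ (n + 2 : ℕ) f x) (a b : E) (u : Fin n → E) :
    iteratedFDeriv ℝ (n + 2) f x (Fin.cons a (Fin.cons b u : Fin (n + 1) → E)) =
      iteratedFDeriv ℝ (n + 2) f x (Fin.cons b (Fin.cons a u : Fin (n + 1) → E)) := by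
  set g : E → F := fun y => iteratedFDeriv ℝ n f y u with hg
  have hgC : ContDiffAt ℝ 2 g x :=
    (ContinuousMultilinearMap.apply ℝ (fun _ : Fin n => E) F u).contDiff.contDiffAt.comp x
      (hf.iteratedFDeriv_right (m := 2) (by norm_cast; omega))
  have key (a b : E) :
      iteratedFDeriv ℝ (n + 2) f x (Fin.cons a (Fin.cons b u : Fin (n + 1) → E)) =
        fderiv ℝ (fderiv ℝ g) x a b := by
    rw [(hf.differentiableAt_iteratedFDeriv
      (by norm_cast; omega)).iteratedFDeriv_succ_apply_left']
    simp only [Fin.tail_cons, Fin.cons_zero]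
    have hev : (fun y => iteratedFDeriv ℝ (n + 1) f y (Fin.cons b u : Fin (n + 1) → E))
        =ᶠ[𝓝 x] fun y => fderiv ℝ g y b := by
      filter_upwards [hf.eventually (ENat.natCast_ne_coe_top _)] with y hy
      rw [(hy.differentiableAt_iteratedFDeriv
        (by norm_cast; omega)).iteratedFDeriv_succ_apply_left']
      simp [hg]
    rw [hev.fderiv_eq]
    have hd : DifferentiableAt ℝ (fderiv ℝ g) x :=
      (hgC.fderiv_right (m := 1) (by norm_num)).differentiableAt (by norm_num)
    simp [fderiv_clm_apply hd (differentiableAt_const b)]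
  rw [key, key]
  exact hgC.isSymmSndFDerivAt (by simp) a b

/-- The `n`-th derivative of a real `C^n` function is invariant under permutations of its
arguments. -/
theorem ContDiffAt.iteratedFDeriv_comp_perm_of_real {f : E → F} {n : ℕ} {x : E}
    (hf : ContDiffAt ℝ n f x) (σ : Equiv.Perm (Fin n)) (v : Fin n → E) :
    iteratedFDeriv ℝ n f x (v ∘ σ) = iteratedFDeriv ℝ n f x v := by
  induction n generalizing x with
  | zero => congr 1; exact Subsingleton.elim _ _
  | succ n ih =>
    have hσ : σ ∈ Submonoid.closure
        (Set.range fun i : Fin n => Equiv.swap i.castSucc i.succ) := by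
      rw [Equiv.Perm.mclosure_swap_castSucc_succ]; trivial
    induction hσ using Submonoid.closure_induction generalizing v with
    | one => rfl
    | mul σ τ _ _ hσ hτ =>
      rw [Equiv.Perm.coe_mul, ← Function.comp_assoc, hτ, hσ]
    | mem σ hσ =>
      obtain ⟨i, rfl⟩ := hσ
      cases n with
      | zero => exact i.elim0
      | succ n =>
        induction i using Fin.cases with
        | zero =>
          obtain ⟨a, w, rfl⟩ : ∃ a w, v = Fin.cons a w := ⟨_, _, (Fin.cons_self_tail v).symm⟩
          obtain ⟨b, u, rfl⟩ : ∃ b u, w = Fin.cons b u := ⟨_, _, (Fin.cons_self_tail w).symm⟩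
          rw [hf.iteratedFDeriv_comp_swap_zero_one a b u]
          congr 1
          ext j
          refine Fin.cases ?_ (fun j => Fin.cases ?_ (fun j => ?_) j) j
          · simp
          · simp
          · have h0 : j.succ.succ ≠ 0 := Fin.succ_ne_zero _
            have h1 : j.succ.succ ≠ (0 : Fin (n + 1)).succ :=
              fun h => Fin.succ_ne_zero _ (Fin.succ_injective _ h)
            simp only [Function.comp_apply, Fin.castSucc_zero]
            rw [Equiv.swap_apply_of_ne_of_ne h0 h1]
            simp
        | succ i =>
          have hd : DifferentiableAt ℝ (iteratedFDeriv ℝ (n + 1) f) x :=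
            hf.differentiableAt_iteratedFDeriv (by norm_cast; omega)
          rw [hd.iteratedFDeriv_succ_apply_left', hd.iteratedFDeriv_succ_apply_left']
          have h0 : (v ∘ Equiv.swap i.succ.castSucc i.succ.succ) 0 = v 0 := by
            simp only [Function.comp_apply]
            rw [Equiv.swap_apply_of_ne_of_ne]
            · rw [Fin.castSucc_succ]; exact (Fin.succ_ne_zero _).symm
            · exact (Fin.succ_ne_zero _).symm
          have ht : Fin.tail (v ∘ Equiv.swap i.succ.castSucc i.succ.succ) =
              Fin.tail v ∘ Equiv.swap i.castSucc i.succ := by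
            ext j
            simp only [Fin.tail, Function.comp_apply]
            rw [Fin.castSucc_succ, ← (Fin.succ_injective _).swap_apply]
          rw [h0, ht]
          congr 1
          apply Filter.EventuallyEq.fderiv_eq
          filter_upwards [hf.eventually (ENat.natCast_ne_coe_top _)] with y hy
          exact ih (hy.of_le (by norm_cast; omega)) _ _

end SymmetryOfDerivatives

section TaylorPolynomial

variable {n k : ℕ} {r : (Fin n → ℂ) → ℝ} {p : Fin n → ℂ}

/-- The Taylor polynomial is the sum of the truncated Taylor series. -/
theorem hasFiniteFPowerSeriesOnBall_taylorPoly (n k : ℕ) (r : (Fin n → ℂ) → ℝ)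
    (p : Fin n → ℂ) :
    HasFiniteFPowerSeriesOnBall (taylorPoly n k r p)
      (fun j => if j ≤ k then ((j.factorial : ℝ))⁻¹ • iteratedFDeriv ℝ j r p else 0)
      p (k + 1) ⊤ := by
  refine .mk' (fun j hj => if_neg (by omega)) (by simp) fun y _ => ?_
  refine Finset.sum_congr rfl fun j hj => ?_
  rw [if_pos (by simpa [Nat.lt_succ_iff] using hj)]
  simp

theorem contDiffAt_taylorPoly {N : ℕ∞} :
    ContDiffAt ℝ N (taylorPoly n k r p) p :=
  (hasFiniteFPowerSeriesOnBall_taylorPoly n k r p).hasFPowerSeriesAt.analyticAt.contDiffAt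

theorem iteratedFDeriv_taylorPoly (hr : ContDiffAt ℝ (⊤ : ℕ∞) r p) {j : ℕ} (hj : j ≤ k) :
    iteratedFDeriv ℝ j (taylorPoly n k r p) p = iteratedFDeriv ℝ j r p := by
  ext v
  rw [(hasFiniteFPowerSeriesOnBall_taylorPoly n k r
    p).toHasFPowerSeriesOnBall.iteratedFDeriv_eq_sum_of_completeSpace]
  have hsymm (σ : Equiv.Perm (Fin j)) :
      iteratedFDeriv ℝ j r p (fun i => v (σ i)) = iteratedFDeriv ℝ j r p v :=
    (hr.of_le (by exact_mod_cast le_top)).iteratedFDeriv_comp_perm_of_real σ v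
  have hfac : (j.factorial : ℝ) ≠ 0 := by positivity
  simp [hj, hsymm, Fintype.card_perm, hfac]

theorem taylorPoly_self : taylorPoly n k r p p = r p := by
  have := (hasFiniteFPowerSeriesOnBall_taylorPoly n k r p).coeff_zero (fun _ => 0)
  simpa using this.symm

end TaylorPolynomial

section Composition

variable {E F G : Type*} [NormedAddCommGroup E] [NormedSpace ℝ E]
  [NormedAddCommGroup F] [NormedSpace ℝ F] [NormedAddCommGroup G] [NormedSpace ℝ G]

/-- If the derivatives of `h` of order at most `k` vanish and the derivatives of `γ` of positive
order less than `m` vanish, then the derivatives of `h ∘ γ` of order less than `m * (k + 1)`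
vanish. -/
theorem iteratedFDeriv_comp_eq_zero {h : F → G} {γ : E → F} {x : E} {k m : ℕ}
    (hh : ContDiffAt ℝ (⊤ : ℕ∞) h (γ x)) (hγ : ContDiffAt ℝ (⊤ : ℕ∞) γ x)
    (hh0 : ∀ j ≤ k, iteratedFDeriv ℝ j h (γ x) = 0)
    (hγ0 : ∀ j, 0 < j → j < m → iteratedFDeriv ℝ j γ x = 0) {j : ℕ} (hj : j < m * (k + 1)) :
    iteratedFDeriv ℝ j (h ∘ γ) x = 0 := by
  rw [iteratedFDeriv_comp hh hγ (by exact_mod_cast le_top)]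
  refine Finset.sum_eq_zero fun c _ => ?_
  ext v
  rw [FormalMultilinearSeries.compAlongOrderedFinpartition_apply]
  by_cases hc : c.length ≤ k
  · simp [ftaylorSeries, hh0 _ hc]
  · obtain ⟨i, hi⟩ : ∃ i, c.partSize i < m := by
      by_contra! hcon
      have hsum : ∑ i, c.partSize i = j := by
        simpa using c.sum_sigma_eq_sum (fun _ => (1 : ℕ))
      have hle : ∑ _i : Fin c.length, m ≤ ∑ i, c.partSize i :=
        Finset.sum_le_sum fun i _ => hcon i
      rw [hsum, Finset.sum_const, Finset.card_univ, Fintype.card_fin, smul_eq_mul] at hle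
      have : m * (k + 1) ≤ m * c.length := Nat.mul_le_mul_left m (by omega)
      rw [mul_comm c.length] at hle
      omega
    refine ContinuousMultilinearMap.map_coord_zero _ i ?_
    simp [OrderedFinpartition.applyOrderedFinpartition, ftaylorSeries,
      hγ0 _ (c.partSize_pos i) hi]

end Composition

section VanishingOrder

variable {E F : Type*} [NormedAddCommGroup E] [NormedSpace ℝ E]
  [NormedAddCommGroup F] [NormedSpace ℝ F]

theorem iteratedFDeriv_eq_zero_of_lt_vOrder {f : E → F} {m : ℕ}
    (h : (m : ℝ≥0∞) < vOrder f) : iteratedFDeriv ℝ m f 0 = 0 := by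
  by_contra hm
  exact h.not_ge (iInf₂_le m hm)

theorem exists_vOrder_eq_natCast {f : E → F} (h : vOrder f ≠ ⊤) :
    ∃ m : ℕ, vOrder f = m := by
  classical
  have hex : ∃ m : ℕ, iteratedFDeriv ℝ m f 0 ≠ 0 := by
    by_contra! hcon
    exact h (by simp [vOrder, hcon])
  exact ⟨Nat.find hex, le_antisymm
    (iInf₂_le (f := fun (m : ℕ) _ => (m : ℝ≥0∞)) _ (Nat.find_spec hex))
    (le_iInf₂ fun m hm => by exact_mod_cast Nat.find_min' hex hm)⟩

theorem inf_vOrder_le {f g : E → F} {N : ℕ}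
    (h : ∀ j < N, iteratedFDeriv ℝ j f 0 = iteratedFDeriv ℝ j g 0) :
    (N : ℝ≥0∞) ⊓ vOrder f ≤ vOrder g := by
  refine le_iInf₂ fun m hm => ?_
  rcases lt_or_ge m N with hmN | hmN
  · exact inf_le_right.trans (iInf₂_le m (by simpa [h m hmN] using hm))
  · exact inf_le_left.trans (by exact_mod_cast hmN)

theorem exists_nuCurve_eq_natCast {n : ℕ} {γ : ℂ → Fin n → ℂ} {p : Fin n → ℂ}
    (h : nuCurve γ p ≠ ⊤) : ∃ m : ℕ, nuCurve γ p = m := by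
  cases n with
  | zero => exact absurd (by simp [nuCurve]) h
  | succ n =>
    obtain ⟨i, hi⟩ := exists_eq_ciInf_of_finite (f := fun i => vOrder fun t => γ t i - p i)
    change _ = nuCurve γ p at hi
    rw [← hi] at h ⊢
    exact exists_vOrder_eq_natCast h

theorem nuCurve_ne_zero {n : ℕ} {γ : ℂ → Fin n → ℂ} {p : Fin n → ℂ} (h : γ 0 = p) :
    nuCurve γ p ≠ 0 := by
  have : 1 ≤ nuCurve γ p := by
    refine le_iInf fun i => le_iInf₂ fun m hm => ?_
    have hm0 : m ≠ 0 := by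
      rintro rfl
      refine hm ?_
      ext
      simp [h]
    exact_mod_cast Nat.one_le_iff_ne_zero.2 hm0
  exact (zero_lt_one.trans_le this).ne'

theorem iteratedFDeriv_eq_zero_of_lt_nuCurve {n : ℕ} {γ : ℂ → Fin n → ℂ} {p : Fin n → ℂ}
    (hγ : ContDiffAt ℝ (⊤ : ℕ∞) γ 0) {j : ℕ} (hj0 : 0 < j) (hj : (j : ℝ≥0∞) < nuCurve γ p) :
    iteratedFDeriv ℝ j γ 0 = 0 := by
  have hγj : ContDiffAt ℝ j γ 0 := hγ.of_le (by exact_mod_cast le_top)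
  ext v i
  have h0 := iteratedFDeriv_eq_zero_of_lt_vOrder (hj.trans_le (iInf_le _ i))
  have hproj : iteratedFDeriv ℝ j (fun t => γ t i) 0 = _ :=
    (ContinuousLinearMap.proj (R := ℝ) (φ := fun _ : Fin n => ℂ) i).iteratedFDeriv_comp_left
      hγj le_rfl
  rw [fun_iteratedFDeriv_sub_apply (contDiffAt_pi.1 hγj i) contDiffAt_const,
    iteratedFDeriv_const_of_ne hj0.ne', Pi.zero_apply, sub_zero, hproj] at h0
  exact congrArg (fun L => L v) h0

end VanishingOrder

/-- The pullbacks of `r` and of its `k`-th Taylor polynomial to a curve have the same derivatives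
of order less than `ν(γ) * (k + 1)`. -/
theorem iteratedFDeriv_comp_curve_eq {n k m : ℕ} {r : (Fin n → ℂ) → ℝ} {p : Fin n → ℂ}
    {γ : ℂ → Fin n → ℂ} (hr : ContDiffAt ℝ (⊤ : ℕ∞) r p) (hγ : ContDiffAt ℝ (⊤ : ℕ∞) γ 0)
    (hγp : γ 0 = p) (hm : nuCurve γ p = m) {j : ℕ} (hj : j < m * (k + 1)) :
    iteratedFDeriv ℝ j (fun t => r (γ t) - r p) 0 =
      iteratedFDeriv ℝ j (fun t => taylorPoly n k r p (γ t) - taylorPoly n k r p p) 0 := by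
  subst hγp
  set T := taylorPoly n k r (γ 0)
  have hT : ContDiffAt ℝ (⊤ : ℕ∞) T (γ 0) := contDiffAt_taylorPoly
  have hle : (j : WithTop ℕ∞) ≤ ((⊤ : ℕ∞) : WithTop ℕ∞) := by exact_mod_cast le_top
  have hz : iteratedFDeriv ℝ j ((r - T) ∘ γ) 0 = 0 := by
    refine iteratedFDeriv_comp_eq_zero (k := k) (m := m) (h := r - T) (hr.sub hT) hγ (fun i hi => ?_)
      (fun i hi0 him => iteratedFDeriv_eq_zero_of_lt_nuCurve hγ hi0
        (by rw [hm]; exact_mod_cast him)) hj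
    have hle : (i : WithTop ℕ∞) ≤ ((⊤ : ℕ∞) : WithTop ℕ∞) := by exact_mod_cast le_top
    rw [iteratedFDeriv_sub_apply (hr.of_le hle) (hT.of_le hle),
      iteratedFDeriv_taylorPoly hr hi, sub_self]
  have hfun : (r - T) ∘ γ =
      (fun t => r (γ t) - r (γ 0)) - fun t => T (γ t) - T (γ 0) := by
    have hT0 : T (γ 0) = r (γ 0) := taylorPoly_self
    ext t
    simp [hT0]
  have hrγ : ContDiffAt ℝ j (fun t => r (γ t) - r (γ 0)) 0 :=
    ((hr.comp 0 hγ).sub contDiffAt_const).of_le hle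
  have hTγ : ContDiffAt ℝ j (fun t => T (γ t) - T (γ 0)) 0 :=
    ((hT.comp 0 hγ).sub contDiffAt_const).of_le hle
  rw [hfun, iteratedFDeriv_sub_apply hrγ hTγ] at hz
  exact sub_eq_zero.1 hz

theorem inf_div_le_div {m N : ℕ} {a b : ℝ≥0∞} (hm : (m : ℝ≥0∞) ≠ 0)
    (h : ((m * N : ℕ) : ℝ≥0∞) ⊓ a ≤ b) : (N : ℝ≥0∞) ⊓ (a / m) ≤ b / m := by
  rcases inf_le_iff.1 h with h | h
  · refine inf_le_left.trans ?_
    rw [ENNReal.le_div_iff_mul_le (Or.inl hm) (Or.inl (ENNReal.natCast_ne_top m)), mul_comm]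
    exact_mod_cast h
  · exact inf_le_right.trans (ENNReal.div_le_div_right h _)

theorem iInf₂_le_of_inf_le {ι : Type*} {S : Set ι} {a b : ι → ℝ≥0∞} {c : ℝ≥0∞}
    (h : ∀ i ∈ S, c ⊓ a i ≤ b i) (hb : ⨅ i ∈ S, b i < c) :
    ⨅ i ∈ S, a i ≤ ⨅ i ∈ S, b i := by
  have : c ⊓ ⨅ i ∈ S, a i ≤ ⨅ i ∈ S, b i :=
    le_iInf₂ fun i hi => (inf_le_inf_left c (iInf₂_le i hi)).trans (h i hi)
  exact (inf_le_iff.1 this).resolve_left hb.not_ge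

/-- If `Δ(M_k, p) < k` for some positive integer `k`, then `Δ(M, p) = Δ(M_k, p)`. -/
theorem delta_eq_deltaK_of_deltaK_lt (n : ℕ) (M : Set (Fin n → ℂ)) (p : Fin n → ℂ)
    (hp : p ∈ M) (k : ℕ) (hk : 0 < k) (h : DeltaK n M p k < (k : ℝ≥0∞)) :
    Delta n M p = DeltaK n M p k := by
  refine iSup_congr fun γ => iSup_congr fun hγ => ?_
  have hlt : ⨅ r ∈ IMp n M p, vOrder (fun t => taylorPoly n k r p (γ t) -
      taylorPoly n k r p p) / nuCurve γ p < ((k + 1 : ℕ) : ℝ≥0∞) :=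
    ((le_iSup₂ (f := fun γ (_ : γ ∈ Curves n p) => ⨅ r ∈ IMp n M p,
      vOrder (fun t => taylorPoly n k r p (γ t) - taylorPoly n k r p p) / nuCurve γ p)
      γ hγ).trans_lt h).trans (by exact_mod_cast k.lt_succ_self)
  obtain ⟨hγa, hγp, -⟩ := hγ
  by_cases htop : nuCurve γ p = ⊤
  · simp [htop]
  obtain ⟨m, hm⟩ := exists_nuCurve_eq_natCast htop
  have hm0 : (m : ℝ≥0∞) ≠ 0 := hm ▸ nuCurve_ne_zero hγp
  have hγC : ContDiffAt ℝ (⊤ : ℕ∞) γ 0 := hγa.contDiffAt.restrict_scalars ℝ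
  have hder (r) (hr : r ∈ IMp n M p) (j) (hj : j < m * (k + 1)) :
      iteratedFDeriv ℝ j (fun t => r (γ t) - r p) 0 =
        iteratedFDeriv ℝ j (fun t => taylorPoly n k r p (γ t) - taylorPoly n k r p p) 0 :=
    have ⟨_, hU, hpU, hrU, _⟩ := hr
    iteratedFDeriv_comp_curve_eq (hrU.contDiffAt (hU.mem_nhds hpU)) hγC hγp hm hj
  rw [hm] at hlt ⊢
  have hle := iInf₂_le_of_inf_le
    (fun r hr => inf_div_le_div hm0 (inf_vOrder_le (hder r hr))) hlt
  exact hle.antisymm (iInf₂_le_of_inf_le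
    (fun r hr => inf_div_le_div hm0 (inf_vOrder_le fun j hj => (hder r hr j hj).symm))
    (hle.trans_lt hlt))
end

section
/- Let M ⊂ ℂⁿ be a subset containing a point p, let k be a positive integer, and let N be a positive integer. Suppose that for each r ∈ I_M(p) we are given a holomorphic polynomial h^r on ℂⁿ and holomorphic polynomial mappings f^r, g^r : ℂⁿ → ℂ^N such that r_k = Re(h^r) + ‖f^r‖² − ‖g^r‖² as functions on ℂⁿ. For each unitary matrix U ∈ 𝒰(N), let I(U) ⊂ 𝒪_p denote the ideal generated by the set {h^r, components of f^r − U g^r : r ∈ I_M(p)}. Then sup_{U ∈ 𝒰(N)} τ(I(U)) ≤ Δ(M_k, p). -/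
open scoped ENNReal Topology

/-- The ideal in the ring `𝒪_p` of germs at `p` of holomorphic functions generated by a
set `S` of (representatives of) holomorphic germs: a function belongs to it iff, near `p`,
it agrees with a finite combination `∑ aᵢ gᵢ` with `aᵢ` holomorphic germs at `p`, `gᵢ ∈ S`. -/
def idealGen (n : ℕ) (p : Fin n → ℂ) (S : Set ((Fin n → ℂ) → ℂ)) :
    Set ((Fin n → ℂ) → ℂ) :=
  {φ | ∃ (m : ℕ) (a g : Fin m → (Fin n → ℂ) → ℂ),
    (∀ i, AnalyticAt ℂ (a i) p) ∧ (∀ i, g i ∈ S) ∧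
    ∀ᶠ z in 𝓝 p, φ z = ∑ i, a i z * g i z}

/-- `τ(I) = sup_{γ ∈ 𝒞} inf_{φ ∈ I} ν(φ∘γ)/ν(γ)` for a set `I` of holomorphic germs at `p`. -/
noncomputable def tau (n : ℕ) (p : Fin n → ℂ) (I : Set ((Fin n → ℂ) → ℂ)) : ℝ≥0∞ :=
  ⨆ γ ∈ Curves n p, ⨅ φ ∈ I, vOrder (fun t => φ (γ t) - φ p) / nuCurve γ p

/-- `φ` is of class `C^m` at `0` and its derivatives of order up to order `m` vanish there. -/
def FlatToOrder {E F : Type*} [NormedAddCommGroup E] [NormedSpace ℝ E]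
    [NormedAddCommGroup F] [NormedSpace ℝ F] (m : ℕ) (φ : E → F) : Prop :=
  ContDiffAt ℝ m φ 0 ∧ ∀ i ≤ m, iteratedFDeriv ℝ i φ 0 = 0

namespace FlatToOrder

variable {E F G A : Type*} [NormedAddCommGroup E] [NormedSpace ℝ E]
  [NormedAddCommGroup F] [NormedSpace ℝ F] [NormedAddCommGroup G] [NormedSpace ℝ G]
  [NormedRing A] [NormedAlgebra ℝ A] {m : ℕ}

theorem sum {ι : Type*} {s : Finset ι} {φ : ι → E → F}
    (hφ : ∀ i ∈ s, FlatToOrder m (φ i)) : FlatToOrder m (fun x => ∑ i ∈ s, φ i x) := by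
  refine ⟨ContDiffAt.sum fun i hi => (hφ i hi).1, fun j hj => ?_⟩
  rw [iteratedFDeriv_fun_sum_apply fun i hi => (hφ i hi).1.of_le (by exact_mod_cast hj)]
  exact Finset.sum_eq_zero fun i hi => (hφ i hi).2 j hj

theorem add {φ ψ : E → F} (hφ : FlatToOrder m φ) (hψ : FlatToOrder m ψ) :
    FlatToOrder m (fun x => φ x + ψ x) := by
  refine ⟨hφ.1.add hψ.1, fun j hj => ?_⟩
  rw [fun_iteratedFDeriv_add_apply (hφ.1.of_le (by exact_mod_cast hj))
    (hψ.1.of_le (by exact_mod_cast hj)), hφ.2 j hj, hψ.2 j hj, add_zero]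

theorem clm_comp {φ : E → F} (hφ : FlatToOrder m φ) (L : F →L[ℝ] G) :
    FlatToOrder m (fun x => L (φ x)) := by
  refine ⟨L.contDiff.contDiffAt.comp 0 hφ.1, fun j hj => ?_⟩
  change iteratedFDeriv ℝ j (L ∘ φ) 0 = 0
  rw [L.iteratedFDeriv_comp_left hφ.1 (by exact_mod_cast hj), hφ.2 j hj]
  ext
  simp

theorem sub {φ ψ : E → F} (hφ : FlatToOrder m φ) (hψ : FlatToOrder m ψ) :
    FlatToOrder m (fun x => φ x - ψ x) := by
  simpa [sub_eq_add_neg] using hφ.add (hψ.clm_comp (-ContinuousLinearMap.id ℝ F))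

theorem mul_contDiffAt {φ ψ : E → A} (hφ : FlatToOrder m φ) (hψ : ContDiffAt ℝ m ψ 0) :
    FlatToOrder m (fun x => φ x * ψ x) := by
  refine ⟨hφ.1.mul hψ, fun j hj => ?_⟩
  obtain ⟨u, hu, hφu⟩ := hφ.1.contDiffOn le_rfl (by simp)
  obtain ⟨v, hv, hψv⟩ := hψ.contDiffOn le_rfl (by simp)
  obtain ⟨s, hs, hso, h0⟩ := mem_nhds_iff.1 (Filter.inter_mem hu hv)
  have key := norm_iteratedFDerivWithin_mul_le (hφu.mono fun x hx => (hs hx).1)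
    (hψv.mono fun x hx => (hs hx).2) hso.uniqueDiffOn h0 (n := j) (by exact_mod_cast hj)
  rw [iteratedFDerivWithin_of_isOpen j hso h0] at key
  refine norm_le_zero_iff.1 (key.trans (Finset.sum_eq_zero fun i hi => ?_).le)
  rw [iteratedFDerivWithin_of_isOpen i hso h0,
    hφ.2 i ((Nat.lt_succ_iff.1 (Finset.mem_range.1 hi)).trans hj)]
  simp

end FlatToOrder

theorem vOrder_eq_top_or_exists {E F : Type*} [NormedAddCommGroup E] [NormedSpace ℝ E]
    [NormedAddCommGroup F] [NormedSpace ℝ F] (φ : E → F) :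
    vOrder φ = ⊤ ∨ ∃ m : ℕ, iteratedFDeriv ℝ m φ 0 ≠ 0 ∧ vOrder φ = m := by
  classical
  by_cases hex : ∃ m : ℕ, iteratedFDeriv ℝ m φ 0 ≠ 0
  · refine Or.inr ⟨Nat.find hex, Nat.find_spec hex, le_antisymm ?_ ?_⟩
    · exact iInf₂_le (Nat.find hex) (Nat.find_spec hex)
    · exact le_iInf₂ fun m hm => by exact_mod_cast Nat.find_min' hex hm
  · push Not at hex
    exact Or.inl (by simp [vOrder, hex])

theorem flatToOrder_of_lt_vOrder {E F : Type*} [NormedAddCommGroup E] [NormedSpace ℝ E]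
    [NormedAddCommGroup F] [NormedSpace ℝ F] {φ : E → F} {m : ℕ}
    (hφ : ContDiffAt ℝ m φ 0) (hm : (m : ℝ≥0∞) < vOrder φ) : FlatToOrder m φ := by
  refine ⟨hφ, fun i hi => ?_⟩
  by_contra hne
  have hle : vOrder φ ≤ i := iInf₂_le i hne
  exact absurd (hm.trans_le hle) (not_lt.2 (by exact_mod_cast hi))

theorem AnalyticAt.contDiffAt_real {E F : Type*} [NormedAddCommGroup E] [NormedSpace ℂ E]
    [NormedAddCommGroup F] [NormedSpace ℂ F] [CompleteSpace F] {φ : E → F} {x : E}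
    (hφ : AnalyticAt ℂ φ x) (m : ℕ) : ContDiffAt ℝ m φ x :=
  hφ.contDiffAt.restrict_scalars ℝ

theorem analyticAt_of_eq_mvPolynomial_eval {n : ℕ} {φ : (Fin n → ℂ) → ℂ}
    (hφ : ∃ P : MvPolynomial (Fin n) ℂ, ∀ z, φ z = MvPolynomial.eval z P) (p : Fin n → ℂ) :
    AnalyticAt ℂ φ p := by
  obtain ⟨P, hP⟩ := hφ
  rw [funext hP]
  exact AnalyticOnNhd.eval_continuousLinearMap (ContinuousLinearMap.id ℂ (Fin n → ℂ)) P p trivial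

theorem mem_idealGen_of_mem {n : ℕ} {p : Fin n → ℂ} {S : Set ((Fin n → ℂ) → ℂ)}
    {φ : (Fin n → ℂ) → ℂ} (hφ : φ ∈ S) : φ ∈ idealGen n p S :=
  ⟨1, fun _ _ => 1, fun _ => φ, fun _ => analyticAt_const, fun _ => hφ, by simp⟩

theorem zero_mem_idealGen {n : ℕ} {p : Fin n → ℂ} {S : Set ((Fin n → ℂ) → ℂ)} :
    (fun _ => 0) ∈ idealGen n p S :=
  ⟨0, Fin.elim0, Fin.elim0, fun i => i.elim0, fun i => i.elim0, by simp⟩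

/-- A set of holomorphic germs containing a unit generates the whole ring of germs. -/
theorem mem_idealGen_of_unit_mem {n : ℕ} {p : Fin n → ℂ} {S : Set ((Fin n → ℂ) → ℂ)}
    {φ ψ : (Fin n → ℂ) → ℂ} (hψS : ψ ∈ S) (hψ : AnalyticAt ℂ ψ p) (hψp : ψ p ≠ 0)
    (hφ : AnalyticAt ℂ φ p) : φ ∈ idealGen n p S := by
  refine ⟨1, fun _ z => φ z / ψ z, fun _ => ψ, fun _ => hφ.fun_div hψ hψp, fun _ => hψS, ?_⟩
  filter_upwards [hψ.continuousAt.eventually_ne hψp] with z hz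
  simp [div_mul_cancel₀ _ hz]

theorem Matrix.sum_normSq_mulVec_of_mem_unitaryGroup {ι : Type*} [Fintype ι] [DecidableEq ι]
    (U : Matrix.unitaryGroup ι ℂ) (v : ι → ℂ) :
    ∑ i, Complex.normSq (∑ j, (U : Matrix ι ι ℂ) i j * v j) = ∑ i, Complex.normSq (v i) := by
  have hsum : ∀ w : ι → ℂ, ((∑ i, Complex.normSq (w i) : ℝ) : ℂ) = star w ⬝ᵥ w := fun w => by
    simp [dotProduct, Complex.normSq_eq_conj_mul_self]
  apply Complex.ofReal_injective
  change ((∑ i, Complex.normSq (((U : Matrix ι ι ℂ).mulVec v) i) : ℝ) : ℂ) = _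
  rw [hsum, hsum, Matrix.star_mulVec, Matrix.dotProduct_mulVec, Matrix.vecMul_vecMul,
    ← Matrix.star_eq_conjTranspose, Matrix.UnitaryGroup.star_mul_self, Matrix.vecMul_one]

theorem Complex.normSq_sub_normSq (a b : ℂ) :
    Complex.normSq a - Complex.normSq b = ((a - b) * (starRingEnd ℂ) (a + b)).re := by
  simp [Complex.normSq_apply]
  ring

/-- The order-`m` jet of `Re h + ‖f‖² - ‖g‖²` along a curve is constant as soon as this
holds for `h` and all components of `f` and `g`. -/
theorem flatToOrder_of_jets_constant {N m : ℕ} {H : ℂ → ℂ} {a b : ℂ → Fin N → ℂ}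
    (h0 : ℂ) (a0 b0 : Fin N → ℂ) (hH : FlatToOrder m fun t => H t - h0)
    (ha : ∀ i, FlatToOrder m fun t => a t i - a0 i)
    (hb : ∀ i, FlatToOrder m fun t => b t i - b0 i)
    (hac : ∀ i, ContDiffAt ℝ m (fun t => a t i) 0)
    (hbc : ∀ i, ContDiffAt ℝ m (fun t => b t i) 0) :
    FlatToOrder m fun t =>
      ((H t).re + ∑ i, Complex.normSq (a t i) - ∑ i, Complex.normSq (b t i)) -
      (h0.re + ∑ i, Complex.normSq (a0 i) - ∑ i, Complex.normSq (b0 i)) := by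
  have hnormSq : ∀ (c : ℂ → Fin N → ℂ) (c0 : Fin N → ℂ),
      (∀ i, FlatToOrder m fun t => c t i - c0 i) →
      (∀ i, ContDiffAt ℝ m (fun t => c t i) 0) →
      FlatToOrder m fun t =>
        ∑ i, Complex.normSq (c t i) - ∑ i, Complex.normSq (c0 i) := by
    intro c c0 hc hcc
    simp_rw [← Finset.sum_sub_distrib, Complex.normSq_sub_normSq]
    exact FlatToOrder.sum fun i _ => ((hc i).mul_contDiffAt (Complex.conjCLE.contDiff.contDiffAt.comp
      (0 : ℂ) ((hcc i).add contDiffAt_const))).clm_comp Complex.reCLM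
  convert ((hH.clm_comp Complex.reCLM).add (hnormSq a a0 ha hac)).sub (hnormSq b b0 hb hbc) using 2
  simp
  ring

/-- `Re h + ‖f‖² - ‖g‖²` vanishes to order `m` along a curve as soon as `h` and the components
of `f - U g` do, for some unitary matrix `U`. -/
theorem flatToOrder_of_unitary {N m : ℕ} {H : ℂ → ℂ} {a b : ℂ → Fin N → ℂ}
    (U : Matrix.unitaryGroup (Fin N) ℂ) (hH : FlatToOrder m H)
    (hab : ∀ i, FlatToOrder m fun t =>
      a t i - ∑ j, (U : Matrix (Fin N) (Fin N) ℂ) i j * b t j)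
    (hac : ∀ i, ContDiffAt ℝ m (fun t => a t i) 0)
    (hbc : ∀ i, ContDiffAt ℝ m (fun t => b t i) 0) :
    FlatToOrder m fun t =>
      (H t).re + ∑ i, Complex.normSq (a t i) - ∑ i, Complex.normSq (b t i) := by
  have hdiff : FlatToOrder m fun t =>
      ∑ i, Complex.normSq (a t i) - ∑ i, Complex.normSq (b t i) := by
    have hU := fun t => Matrix.sum_normSq_mulVec_of_mem_unitaryGroup U (b t)
    simp_rw [← hU, ← Finset.sum_sub_distrib, Complex.normSq_sub_normSq]
    exact FlatToOrder.sum fun i _ => ((hab i).mul_contDiffAt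
      (Complex.conjCLE.contDiff.contDiffAt.comp (0 : ℂ) ((hac i).add
        (ContDiffAt.sum fun j _ => contDiffAt_const.mul (hbc j))))).clm_comp Complex.reCLM
  simpa [add_sub_assoc] using (hH.clm_comp Complex.reCLM).add hdiff

theorem analyticAt_of_mem_idealGen {n : ℕ} {p : Fin n → ℂ} {S : Set ((Fin n → ℂ) → ℂ)}
    (hS : ∀ φ ∈ S, AnalyticAt ℂ φ p) {φ : (Fin n → ℂ) → ℂ} (hφ : φ ∈ idealGen n p S) :
    AnalyticAt ℂ φ p := by
  obtain ⟨m, a, g, ha, hg, heq⟩ := hφ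
  exact (Finset.univ.analyticAt_fun_sum fun i _ => (ha i).fun_mul (hS _ (hg i))).congr
    (Filter.EventuallyEq.symm heq)

/-- Given, for each `r ∈ I_M(p)`, a decomposition
`r_k = Re(h^r) + ‖f^r‖² - ‖g^r‖²` with `h^r` a holomorphic polynomial and `f^r, g^r`
holomorphic polynomial mappings into `ℂ^N`, and denoting by `I(U)` the ideal of `𝒪_p`
generated by `{h^r} ∪ {components of f^r - U g^r}` for a unitary `U ∈ 𝒰(N)`, one has
`sup_{U ∈ 𝒰(N)} τ(I(U)) ≤ Δ(M_k, p)`. -/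
theorem sup_tau_le_deltaK (n : ℕ) (M : Set (Fin n → ℂ)) (p : Fin n → ℂ) (hp : p ∈ M)
    (k : ℕ) (hk : 0 < k) (N : ℕ) (hN : 0 < N)
    (h : ((Fin n → ℂ) → ℝ) → (Fin n → ℂ) → ℂ)
    (f g : ((Fin n → ℂ) → ℝ) → (Fin n → ℂ) → Fin N → ℂ)
    (hpoly : ∀ r ∈ IMp n M p,
      (∃ P : MvPolynomial (Fin n) ℂ, ∀ z, h r z = MvPolynomial.eval z P) ∧
      (∀ i, ∃ P : MvPolynomial (Fin n) ℂ, ∀ z, f r z i = MvPolynomial.eval z P) ∧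
      (∀ i, ∃ P : MvPolynomial (Fin n) ℂ, ∀ z, g r z i = MvPolynomial.eval z P))
    (hdec : ∀ r ∈ IMp n M p, ∀ z, taylorPoly n k r p z =
      (h r z).re + ∑ i, Complex.normSq (f r z i) - ∑ i, Complex.normSq (g r z i)) :
    (⨆ U : Matrix.unitaryGroup (Fin N) ℂ,
        tau n p (idealGen n p
          ({φ | ∃ r ∈ IMp n M p, φ = h r} ∪
           {φ | ∃ r ∈ IMp n M p, ∃ i : Fin N,
              φ = fun z => f r z i - ∑ j, (U : Matrix (Fin N) (Fin N) ℂ) i j * g r z j})))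
      ≤ DeltaK n M p k := by
  refine iSup_le fun U => iSup₂_le fun γ hγ => le_iSup₂_of_le γ hγ (le_iInf₂ fun r hr => ?_)
  obtain ⟨hγa, hγ0, -⟩ := hγ
  set S : Set ((Fin n → ℂ) → ℂ) := {φ | ∃ r ∈ IMp n M p, φ = h r} ∪
    {φ | ∃ r ∈ IMp n M p, ∃ i : Fin N,
      φ = fun z => f r z i - ∑ j, (U : Matrix (Fin N) (Fin N) ℂ) i j * g r z j}
  have hh : ∀ r ∈ IMp n M p, AnalyticAt ℂ (h r) p := fun r hr =>
    analyticAt_of_eq_mvPolynomial_eval (hpoly r hr).1 p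
  have hf : ∀ r ∈ IMp n M p, ∀ i, AnalyticAt ℂ (fun z => f r z i) p := fun r hr i =>
    analyticAt_of_eq_mvPolynomial_eval ((hpoly r hr).2.1 i) p
  have hg : ∀ r ∈ IMp n M p, ∀ i, AnalyticAt ℂ (fun z => g r z i) p := fun r hr i =>
    analyticAt_of_eq_mvPolynomial_eval ((hpoly r hr).2.2 i) p
  have hS : ∀ φ ∈ S, AnalyticAt ℂ φ p := by
    rintro φ (⟨r, hr, rfl⟩ | ⟨r, hr, i, rfl⟩)
    · exact hh r hr
    · exact (hf r hr i).fun_sub (Finset.univ.analyticAt_fun_sum fun j _ =>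
        analyticAt_const.fun_mul (hg r hr j))
  have hcurve : ∀ {φ : (Fin n → ℂ) → ℂ}, AnalyticAt ℂ φ p → ∀ m : ℕ,
      ContDiffAt ℝ m (fun t => φ (γ t)) 0 := fun {φ} hφ m =>
    AnalyticAt.contDiffAt_real (AnalyticAt.fun_comp (by rwa [hγ0]) hγa) m
  suffices hmain : ∃ φ ∈ idealGen n p S, vOrder (fun t => φ (γ t) - φ p) ≤
      vOrder (fun t => taylorPoly n k r p (γ t) - taylorPoly n k r p p) by
    obtain ⟨φ, hφ, hle⟩ := hmain
    exact iInf₂_le_of_le φ hφ (ENNReal.div_le_div_right hle _)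
  rcases vOrder_eq_top_or_exists
    (fun t => taylorPoly n k r p (γ t) - taylorPoly n k r p p) with htop | ⟨m, hm, hord⟩
  · exact ⟨_, zero_mem_idealGen, htop ▸ le_top⟩
  by_contra! hlt
  have hflat : ∀ φ ∈ idealGen n p S, FlatToOrder m fun t => φ (γ t) - φ p := fun φ hφ =>
    flatToOrder_of_lt_vOrder
      ((hcurve (analyticAt_of_mem_idealGen hS hφ) m).sub contDiffAt_const) (hord ▸ hlt φ hφ)
  suffices hfl : FlatToOrder m fun t => taylorPoly n k r p (γ t) - taylorPoly n k r p p from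
    hm (hfl.2 m le_rfl)
  simp_rw [hdec r hr]
  by_cases hunit : ∃ ψ ∈ S, ψ p ≠ 0
  · obtain ⟨ψ, hψS, hψp⟩ := hunit
    have hall : ∀ φ, AnalyticAt ℂ φ p → FlatToOrder m fun t => φ (γ t) - φ p := fun φ hφ =>
      hflat φ (mem_idealGen_of_unit_mem hψS (hS ψ hψS) hψp hφ)
    exact flatToOrder_of_jets_constant _ _ _ (hall _ (hh r hr)) (fun i => hall _ (hf r hr i))
      (fun i => hall _ (hg r hr i)) (fun i => hcurve (hf r hr i) m)
      (fun i => hcurve (hg r hr i) m)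
  · push Not at hunit
    have hhS : h r ∈ S := Or.inl ⟨r, hr, rfl⟩
    have hfgS : ∀ i, (fun z => f r z i -
        ∑ j, (U : Matrix (Fin N) (Fin N) ℂ) i j * g r z j) ∈ S := fun i =>
      Or.inr ⟨r, hr, i, rfl⟩
    have hgen : ∀ φ ∈ S, FlatToOrder m fun t => φ (γ t) := fun φ hφ => by
      simpa [hunit φ hφ] using hflat φ (mem_idealGen_of_mem hφ)
    have hp0 : (h r p).re + ∑ i, Complex.normSq (f r p i) -
        ∑ i, Complex.normSq (g r p i) = 0 := by
      rw [hunit _ hhS, ← Matrix.sum_normSq_mulVec_of_mem_unitaryGroup U (g r p)]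
      simp [fun i => sub_eq_zero.1 (hunit _ (hfgS i))]
    simp_rw [hp0, sub_zero]
    exact flatToOrder_of_unitary U (hgen _ hhS) (fun i => hgen _ (hfgS i))
      (fun i => hcurve (hf r hr i) m) (fun i => hcurve (hg r hr i) m)
end
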